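/- Let T be injective, {g_α}_{α∈(0,α₀)} an SRM with each g_α continuous on [0,‖T‖²], R_α = g_α(T*T)T*, ρ ∈ 𝒪, s ∈ 𝒮, and suppose (ρ,s) is an order-source pair for {g_α}. If x ∈ X satisfies ‖R_α T x − x‖ = O(ρ(α)) as α → 0⁺, then x ∈ ran(s(T*T)). -/

import Mathlib

open Filter Topology Set Asymptotics

noncomputable section

/-- `ρ ∈ 𝒪`: non-decreasing, positive on `(0,∞)`, with `ρ(α) → 0` as `α → 0⁺`. -/
def MemO (ρ : ℝ → ℝ) : Prop :=
  (∀ α > (0:ℝ), 0 < ρ α) ∧ (∀ a b : ℝ, 0 < a → a ≤ b → ρ a ≤ ρ b) ∧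
    Tendsto ρ (𝓝[>] (0:ℝ)) (𝓝 0)

/-- `s ∈ 𝒮`: continuous on `[0,∞)`, `s 0 = 0`, nonnegative, positive on `(0,∞)`. -/
def MemS (s : ℝ → ℝ) : Prop :=
  ContinuousOn s (Ici (0:ℝ)) ∧ s 0 = 0 ∧ (∀ t, 0 ≤ t → 0 ≤ s t) ∧ (∀ t, 0 < t → 0 < s t)

/-- Spectral regularization method on `[0,Λ]` (hypotheses H2, H3). -/
def IsSRM (α₀ Λ : ℝ) (g : ℝ → ℝ → ℝ) : Prop :=
  (∃ C > (0:ℝ), ∀ α ∈ Ioo (0:ℝ) α₀, ∀ lam ∈ Icc (0:ℝ) Λ, |lam * g α lam| ≤ C) ∧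
  (∀ lam ∈ Ioc (0:ℝ) Λ, Tendsto (fun α => g α lam) (𝓝[>] (0:ℝ)) (𝓝 (1 / lam)))

/-- `(s,ρ)` is a weak source-order pair: `limsup_{α→0⁺} s(λ)|r_α(λ)|/ρ(α) < ∞` for `λ ∈ (0,Λ]`. -/
def WeakSourceOrderPair (Λ : ℝ) (g : ℝ → ℝ → ℝ) (s ρ : ℝ → ℝ) : Prop :=
  ∀ lam ∈ Ioc (0:ℝ) Λ,
    Filter.limsup (fun α => ((s lam * |1 - lam * g α lam| / ρ α : ℝ) : EReal)) (𝓝[>] (0:ℝ)) < ⊤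

/-- `(s,ρ)` is a strong source-order pair: weak, and the `limsup` is `> 0` for every `λ ∈ (0,Λ]`. -/
def StrongSourceOrderPair (Λ : ℝ) (g : ℝ → ℝ → ℝ) (s ρ : ℝ → ℝ) : Prop :=
  WeakSourceOrderPair Λ g s ρ ∧
  ∀ lam ∈ Ioc (0:ℝ) Λ,
    0 < Filter.limsup (fun α => ((s lam * |1 - lam * g α lam| / ρ α : ℝ) : EReal)) (𝓝[>] (0:ℝ))

/-- `(ρ,s)` is an order-source pair: `∃ γ > 0` and `h → 0` with
`s(λ)|r_α(λ)| ≥ γ ρ(α)` for all `α ∈ (0,α₀)` and `λ ∈ [h(α),Λ]`. -/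
def OrderSourcePair (α₀ Λ : ℝ) (g : ℝ → ℝ → ℝ) (ρ s : ℝ → ℝ) : Prop :=
  ∃ γ > (0:ℝ), ∃ h : ℝ → ℝ, (∀ α ∈ Ioo (0:ℝ) α₀, 0 < h α) ∧
    Tendsto h (𝓝[>] (0:ℝ)) (𝓝 0) ∧
    ∀ α ∈ Ioo (0:ℝ) α₀, ∀ lam ∈ Icc (h α) Λ, γ * ρ α ≤ s lam * |1 - lam * g α lam|

/-- `ρ` is an optimal qualification of `{g_α}`. -/
def OptimalQualification (α₀ Λ : ℝ) (g : ℝ → ℝ → ℝ) (ρ : ℝ → ℝ) : Prop :=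
  ∃ s : ℝ → ℝ, MemS s ∧ StrongSourceOrderPair Λ g s ρ ∧ OrderSourcePair α₀ Λ g ρ s

variable {X Y : Type*} [NormedAddCommGroup X] [InnerProductSpace ℂ X] [CompleteSpace X]
  [NormedAddCommGroup Y] [InnerProductSpace ℂ Y] [CompleteSpace Y]

/-- The spectral regularization operators `R_α = g_α(T*T) T*`. -/
noncomputable def Rop (g : ℝ → ℝ → ℝ) (T : X →L[ℂ] Y) (α : ℝ) : Y →L[ℂ] X :=
  (cfc (g α) ((ContinuousLinearMap.adjoint T).comp T)).comp (ContinuousLinearMap.adjoint T)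

/-- The total error `e(x,δ) = inf_{α∈(0,α₀)} sup_{‖Tx-y‖≤δ} ‖R_α y - x‖`. -/
noncomputable def totErr (α₀ : ℝ) (T : X →L[ℂ] Y) (R : ℝ → Y →L[ℂ] X) (x : X) (δ : ℝ) : ℝ :=
  ⨅ α : Ioo (0:ℝ) α₀, ⨆ y : {y : Y // ‖T x - y‖ ≤ δ}, ‖R α.1 y.1 - x‖

/-- If `f² + k² ≤ g²` on the spectrum of a self-adjoint operator `A`, then
`‖f(A)x‖² + ‖k(A)x‖² ≤ ‖g(A)x‖²`. -/
theorem norm_sq_cfc_add_le {A : X →L[ℂ] X} (hA : IsSelfAdjoint A) {f k g : ℝ → ℝ}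
    (hf : ContinuousOn f (spectrum ℝ A)) (hk : ContinuousOn k (spectrum ℝ A))
    (hg : ContinuousOn g (spectrum ℝ A))
    (h : ∀ t ∈ spectrum ℝ A, f t ^ 2 + k t ^ 2 ≤ g t ^ 2) (x : X) :
    ‖cfc f A x‖ ^ 2 + ‖cfc k A x‖ ^ 2 ≤ ‖cfc g A x‖ ^ 2 := by
  have norm_sq (q : ℝ → ℝ) (hq : ContinuousOn q (spectrum ℝ A)) :
      ‖cfc q A x‖ ^ 2 = (inner ℂ (cfc (fun t => q t ^ 2) A x) x).re := by
    have hsa : IsSelfAdjoint (cfc q A) := cfc_predicate q A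
    rw [cfc_pow q 2 A hq, pow_two (cfc q A), mul_apply_eq_comp,
      ← ContinuousLinearMap.adjoint_inner_right, ← ContinuousLinearMap.star_eq_adjoint,
      hsa.star_eq, inner_self_eq_norm_sq_to_K]
    norm_cast
  have hle : cfc (fun t => f t ^ 2 + k t ^ 2) A ≤ cfc (fun t => g t ^ 2) A :=
    cfc_mono h
  rw [cfc_add A (fun t => f t ^ 2) (fun t => k t ^ 2) (hf.pow 2) (hk.pow 2)] at hle
  have hpos := ((ContinuousLinearMap.le_def _ _).1 hle).re_inner_nonneg_left x
  rw [norm_sq f hf, norm_sq k hk, norm_sq g hg]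
  simp only [sub_apply, add_apply, inner_sub_left,
    inner_add_left, map_sub, map_add, RCLike.re_to_complex] at hpos
  linarith

theorem norm_cfc_apply_le {A : X →L[ℂ] X} (hA : IsSelfAdjoint A) {f g : ℝ → ℝ}
    (hf : ContinuousOn f (spectrum ℝ A)) (hg : ContinuousOn g (spectrum ℝ A))
    (h : ∀ t ∈ spectrum ℝ A, |f t| ≤ |g t|) (x : X) :
    ‖cfc f A x‖ ≤ ‖cfc g A x‖ := by
  have := norm_sq_cfc_add_le hA hf (continuousOn_const (c := (0 : ℝ))) hg
    (fun t ht => by simpa using sq_le_sq.2 (h t ht)) x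
  exact le_of_sq_le_sq (by nlinarith [sq_nonneg ‖cfc (fun _ : ℝ => (0 : ℝ)) A x‖])
    (norm_nonneg _)

/-- The piecewise linear cutoff equal to `0` for `t ≤ 1 / N` and to `1` for `t ≥ 2 / N`. -/
def linearCutoff (N t : ℝ) : ℝ := max 0 (min 1 (N * t - 1))

theorem continuous_linearCutoff (N : ℝ) : Continuous (linearCutoff N) := by
  unfold linearCutoff
  fun_prop

theorem linearCutoff_nonneg (N t : ℝ) : 0 ≤ linearCutoff N t := le_max_left _ _

theorem linearCutoff_le_one (N t : ℝ) : linearCutoff N t ≤ 1 :=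
  max_le zero_le_one (min_le_left _ _)

theorem linearCutoff_eq_zero {N t : ℝ} (h : N * t ≤ 1) : linearCutoff N t = 0 :=
  max_eq_left ((min_le_right _ _).trans (by linarith))

theorem linearCutoff_eq_one {N t : ℝ} (h : 2 ≤ N * t) : linearCutoff N t = 1 := by
  unfold linearCutoff
  rw [min_eq_left (by linarith), max_eq_right zero_le_one]

theorem linearCutoff_mono {N M t : ℝ} (h : N ≤ M) (ht : 0 ≤ t) :
    linearCutoff N t ≤ linearCutoff M t := by
  unfold linearCutoff
  gcongr

theorem continuousOn_linearCutoff_div {s : ℝ → ℝ} (hs : MemS s) {N : ℝ} (hN : 0 < N) :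
    ContinuousOn (fun t => linearCutoff N t / s t) (Ici 0) := by
  have hpos (t : ℝ) : 0 < max t (1 / N) := lt_max_of_lt_right (by positivity)
  have hc : Continuous fun t => s (max t (1 / N)) :=
    hs.1.comp_continuous (by fun_prop) fun t => (hpos t).le
  refine ((continuous_linearCutoff N).div hc fun t =>
    (hs.2.2.2 _ (hpos t)).ne').continuousOn.congr fun t ht => ?_
  rcases le_total t (1 / N) with h | h
  · have : N * t ≤ 1 := by rwa [le_div_iff₀ hN, mul_comm] at h
    simp [linearCutoff_eq_zero this]
  · change linearCutoff N t / s t = linearCutoff N t / s (max t (1 / N))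
    rw [max_eq_left h]

theorem spectrum_adjoint_comp_self_subset (T : X →L[ℂ] Y) :
    spectrum ℝ ((ContinuousLinearMap.adjoint T).comp T) ⊆ Icc 0 (‖T‖ ^ 2) := by
  intro t ht
  have hpos : 0 ≤ (ContinuousLinearMap.adjoint T).comp T :=
    (ContinuousLinearMap.nonneg_iff_isPositive _).2
      (ContinuousLinearMap.isPositive_adjoint_comp_self T)
  refine ⟨spectrum_nonneg_of_nonneg hpos ht, ?_⟩
  rcases subsingleton_or_nontrivial X with hX | hX
  · rw [spectrum.of_subsingleton] at ht
    exact ht.elim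
  · have := spectrum.norm_le_norm_of_mem ht
    rw [ContinuousLinearMap.norm_adjoint_comp_self, ← pow_two] at this
    exact (le_abs_self t).trans this

theorem injective_adjoint_comp_self {T : X →L[ℂ] Y} (hinj : Function.Injective T) :
    Function.Injective ((ContinuousLinearMap.adjoint T).comp T) := by
  rw [injective_iff_map_eq_zero]
  intro z hz
  refine (injective_iff_map_eq_zero T).1 hinj z ?_
  have := ContinuousLinearMap.apply_norm_sq_eq_inner_adjoint_left T z
  simpa [hz] using this

theorem sub_Rop_apply (g : ℝ → ℝ → ℝ) (T : X →L[ℂ] Y) {α : ℝ}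
    (hg : ContinuousOn (g α) (Icc 0 (‖T‖ ^ 2))) (x : X) :
    cfc (fun t => 1 - t * g α t) ((ContinuousLinearMap.adjoint T).comp T) x =
      x - Rop g T α (T x) := by
  have hA : IsSelfAdjoint ((ContinuousLinearMap.adjoint T).comp T) :=
    (ContinuousLinearMap.isPositive_adjoint_comp_self T).isSelfAdjoint
  have hg' := hg.mono (spectrum_adjoint_comp_self_subset T)
  have hcomm : (fun t => 1 - t * g α t) = fun t => 1 - g α t * t := by
    ext t
    ring
  rw [hcomm, cfc_sub (fun _ => 1) (fun t => g α t * t) _ continuousOn_const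
      (hg'.mul continuousOn_id),
    cfc_const_one ℝ _, cfc_mul (g α) (fun t => t) _ hg' continuousOn_id, cfc_id' ℝ _]
  simp [Rop]

/-- If the truncations `(linearCutoff N / s)(A) x` are bounded in norm and `A` is an injective
self-adjoint operator with nonnegative spectrum, then `x` is in the range of `s(A)`. -/
theorem mem_range_cfc_of_bounded {A : X →L[ℂ] X} (hA : IsSelfAdjoint A)
    (hspec : spectrum ℝ A ⊆ Ici 0) (hinj : Function.Injective A) {s : ℝ → ℝ} (hs : MemS s)
    {x : X} {K : ℝ}
    (hK : ∀ n : ℕ, ‖cfc (fun t => linearCutoff (n + 1) t / s t) A x‖ ≤ K) :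
    x ∈ Set.range (fun z => cfc s A z) := by
  have hN (n : ℕ) : (0 : ℝ) < n + 1 := by positivity
  have hf (n : ℕ) : ContinuousOn (fun t => linearCutoff (n + 1) t / s t) (spectrum ℝ A) :=
    (continuousOn_linearCutoff_div hs (hN n)).mono hspec
  have hsc : ContinuousOn s (spectrum ℝ A) := hs.1.mono hspec
  set u : ℕ → X := fun n => cfc (fun t => linearCutoff (n + 1) t / s t) A x with hu
  have hstep (n m : ℕ) (hnm : n ≤ m) : ‖u n‖ ^ 2 + ‖u m - u n‖ ^ 2 ≤ ‖u m‖ ^ 2 := by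
    have := norm_sq_cfc_add_le hA (hf n) ((hf m).sub (hf n)) (hf m) (fun t ht => by
      have h0 : 0 ≤ linearCutoff (n + 1) t / s t :=
        div_nonneg (linearCutoff_nonneg _ _) (hs.2.2.1 t (hspec ht))
      have h1 : linearCutoff (n + 1) t / s t ≤ linearCutoff (m + 1) t / s t :=
        div_le_div_of_nonneg_right (linearCutoff_mono (by gcongr) (hspec ht))
          (hs.2.2.1 t (hspec ht))
      simp only [Pi.sub_apply]
      nlinarith) x
    have hsub := cfc_sub (fun t => linearCutoff (m + 1) t / s t)
      (fun t => linearCutoff (n + 1) t / s t) A (hf m) (hf n)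
    have hsub' : cfc ((fun t => linearCutoff (m + 1) t / s t) -
      (fun t => linearCutoff (n + 1) t / s t)) A x = u m - u n := by
      change cfc (fun t => linearCutoff (m + 1) t / s t - linearCutoff (n + 1) t / s t) A x = _
      rw [hsub]
      rfl
    rwa [hsub'] at this
  have hmono : Monotone fun n => ‖u n‖ ^ 2 := fun n m hnm => by
    nlinarith [hstep n m hnm, sq_nonneg ‖u m - u n‖]
  have hbdd : BddAbove (Set.range fun n => ‖u n‖ ^ 2) := by
    refine ⟨K ^ 2, ?_⟩
    rintro _ ⟨n, rfl⟩
    exact pow_le_pow_left₀ (norm_nonneg _) (hK n) 2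
  have hlim := tendsto_atTop_ciSup hmono hbdd
  set L := ⨆ n, ‖u n‖ ^ 2
  have hcauchy : CauchySeq u := by
    refine cauchySeq_of_le_tendsto_0' (fun n => √(L - ‖u n‖ ^ 2)) (fun n m hnm => ?_) ?_
    · rw [dist_comm, dist_eq_norm]
      refine Real.le_sqrt_of_sq_le ?_
      have := le_ciSup hbdd m
      linarith [hstep n m hnm]
    · have := ((tendsto_const_nhds (x := L)).sub hlim).sqrt
      simpa using this
  obtain ⟨v, hv⟩ := cauchySeq_tendsto_of_complete hcauchy
  have hsu (n : ℕ) : cfc s A (u n) = cfc (linearCutoff (n + 1)) A x := by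
    rw [hu, ← mul_apply_eq_comp, ← cfc_mul s _ A hsc (hf n)]
    congr 1
    refine cfc_congr fun t ht => ?_
    rcases (show (0 : ℝ) ≤ t from hspec ht).eq_or_lt with h | h
    · simp [← h, linearCutoff_eq_zero]
    · exact mul_div_cancel₀ _ (hs.2.2.2 t h).ne'
  have hbound (n : ℕ) : ‖A (cfc s A (u n)) - A x‖ ≤ 2 * ‖x‖ * (1 / ((n : ℝ) + 1)) := by
    have hc := (continuous_linearCutoff ((n : ℝ) + 1)).continuousOn (s := spectrum ℝ A)
    have heq : cfc (fun t => t * linearCutoff (n + 1) t - t) A x =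
        A (cfc s A (u n)) - A x := by
      rw [cfc_sub (fun t => t * linearCutoff (n + 1) t) (fun t => t) A
        (continuousOn_id.mul hc) continuousOn_id,
        cfc_mul (fun t => t) _ A continuousOn_id hc, cfc_id' ℝ A, hsu]
      rfl
    have hle := norm_cfc_apply_le hA ((continuousOn_id.mul hc).sub continuousOn_id)
      (continuousOn_const (c := 2 / ((n : ℝ) + 1))) (fun t ht => by
        have ht0 : (0 : ℝ) ≤ t := hspec ht
        have h0 := linearCutoff_nonneg ((n : ℝ) + 1) t
        have h1 := linearCutoff_le_one ((n : ℝ) + 1) t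
        simp only [Pi.sub_apply, Pi.mul_apply, id]
        rw [abs_of_nonneg (a := 2 / ((n : ℝ) + 1)) (by positivity), abs_le]
        rcases le_total 2 (((n : ℝ) + 1) * t) with h | h
        · rw [linearCutoff_eq_one h]
          constructor
          · have : 0 ≤ 2 / ((n : ℝ) + 1) := by positivity
            linarith
          · have : 0 ≤ 2 / ((n : ℝ) + 1) := by positivity
            linarith
        · have : t ≤ 2 / ((n : ℝ) + 1) := by
            rw [le_div_iff₀ (hN n)]
            linarith
          constructor <;> nlinarith) x
    rw [cfc_const _ A] at hle
    rw [← heq]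
    refine hle.trans (le_of_eq ?_)
    rw [Algebra.algebraMap_eq_smul_one]
    simp only [smul_apply, one_apply_eq_self, norm_smul]
    rw [Real.norm_of_nonneg (by positivity)]
    ring
  have hzero : Tendsto (fun n => A (cfc s A (u n)) - A x) atTop (𝓝 0) := by
    refine squeeze_zero_norm hbound ?_
    simpa using tendsto_one_div_add_atTop_nhds_zero_nat.const_mul (2 * ‖x‖)
  have hlimit : Tendsto (fun n => A (cfc s A (u n)) - A x) atTop (𝓝 (A (cfc s A v) - A x)) :=
    ((A.continuous.tendsto _).comp (((cfc s A).continuous.tendsto v).comp hv)).sub_const _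
  exact ⟨v, hinj (sub_eq_zero.1 (tendsto_nhds_unique hlimit hzero))⟩

/-- if `(ρ,s)` is an order-source pair for an SRM `{g_α}` and
`‖R_α T x - x‖ = O(ρ(α))` as `α → 0⁺`, then `x ∈ ran(s(T*T))`. -/
theorem stmt8 (T : X →L[ℂ] Y) (hT : ¬ IsClosed (Set.range T))
    (hinj : Function.Injective T)
    (α₀ : ℝ) (hα₀ : 0 < α₀) (g : ℝ → ℝ → ℝ) (hg : IsSRM α₀ (‖T‖^2) g)
    (hgc : ∀ α ∈ Ioo (0:ℝ) α₀, ContinuousOn (g α) (Icc (0:ℝ) (‖T‖^2)))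
    (ρ s : ℝ → ℝ) (hρ : MemO ρ) (hs : MemS s)
    (hos : OrderSourcePair α₀ (‖T‖^2) g ρ s)
    (x : X)
    (hx : (fun α => ‖Rop g T α (T x) - x‖) =O[𝓝[>] (0:ℝ)] ρ) :
    x ∈ Set.range (fun z => cfc s ((ContinuousLinearMap.adjoint T).comp T) z) := by
  set A := (ContinuousLinearMap.adjoint T).comp T
  have hA : IsSelfAdjoint A :=
    (ContinuousLinearMap.isPositive_adjoint_comp_self T).isSelfAdjoint
  have hspec : spectrum ℝ A ⊆ Icc 0 (‖T‖ ^ 2) := spectrum_adjoint_comp_self_subset T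
  have hspec' : spectrum ℝ A ⊆ Ici 0 := hspec.trans Icc_subset_Ici_self
  obtain ⟨γ, hγ, h, -, hh, hle⟩ := hos
  obtain ⟨M, hM⟩ := hx.bound
  refine mem_range_cfc_of_bounded hA hspec' (injective_adjoint_comp_self hinj) hs
    (K := M / γ) fun n => ?_
  have hN : (0 : ℝ) < n + 1 := by positivity
  obtain ⟨α, hMα, hhα, hα⟩ := (hM.and ((hh.eventually_lt_const
    (show (0 : ℝ) < 1 / (n + 1) by positivity)).and (Ioo_mem_nhdsGT hα₀))).exists
  have hρα := hρ.1 α hα.1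
  have hf : ContinuousOn (fun t => linearCutoff (n + 1) t / s t) (spectrum ℝ A) :=
    (continuousOn_linearCutoff_div hs hN).mono hspec'
  have hr : ContinuousOn (fun t => 1 - t * g α t) (spectrum ℝ A) :=
    continuousOn_const.sub (continuousOn_id.mul ((hgc α hα).mono hspec))
  have key := norm_cfc_apply_le hA (f := fun t => (γ * ρ α) * (linearCutoff (n + 1) t / s t))
    (continuousOn_const.mul hf) hr (fun t ht => by
      have ht0 : (0 : ℝ) ≤ t := hspec' ht
      rw [abs_of_nonneg (mul_nonneg (by positivity)
        (div_nonneg (linearCutoff_nonneg _ _) (hs.2.2.1 t ht0)))]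
      rcases le_total t (1 / ((n : ℝ) + 1)) with h1 | h1
      · rw [le_div_iff₀ hN, mul_comm] at h1
        simp [linearCutoff_eq_zero h1]
      · have hst : 0 < s t := hs.2.2.2 t (lt_of_lt_of_le (by positivity) h1)
        rw [← mul_div_assoc, div_le_iff₀ hst, mul_comm |_|]
        exact (mul_le_of_le_one_right (by positivity) (linearCutoff_le_one _ _)).trans
          (hle α hα t ⟨hhα.le.trans h1, (hspec ht).2⟩)) x
  rw [cfc_const_mul (γ * ρ α) _ A hf, sub_Rop_apply g T (hgc α hα), norm_sub_rev] at key
  simp only [smul_apply, norm_smul, norm_norm] at key hMα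
  rw [Real.norm_of_nonneg (by positivity)] at key
  rw [Real.norm_of_nonneg hρα.le] at hMα
  rw [le_div_iff₀ hγ]
  refine le_of_mul_le_mul_right ?_ hρα
  linarith
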